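/- The R-matrix of U_q(osp(1,2)^) satisfies the graded unitarity relation R₂₁(x) = R(x⁻¹)⁻¹ (equivalently R₂₁(z/w) = R(w/z)⁻¹): over the field ℚ(p,x) one has the 9×9 matrix identity (τ · R(x) · τ) · R(x⁻¹) = I₉, where τ is the graded permutation matrix with entries τ_{(α,β),(α',β')} = δ_{α,β'}·δ_{β,α'}·(−1)^{[α][β]}. -/

import Mathlib

/-- The ℤ/2-grading on the index set {1,2,3} (0-based: indices 0,2 even, index 1 odd). -/
def par (i : Fin 3) : ℕ := if i = 1 then 1 else 0

/-- The R-matrix `R(x)` of `U_q(osp(1,2)^)` over a field `K`, with `q = p^2` and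
spectral parameter `x` (i.e. `z = x`, `w = 1`), indexed by pairs in `{1,2,3} × {1,2,3}`
(written 0-based as `Fin 3 × Fin 3`). -/
noncomputable def Rmat {K : Type*} [Field K] (p x : K) :
    Matrix (Fin 3 × Fin 3) (Fin 3 × Fin 3) K :=
  let q := p ^ 2
  let z := x
  let w : K := 1
  let a := q * (z - w) / (z * q ^ 2 - w)
  let b := w * (q ^ 2 - 1) / (z * q ^ 2 - w)
  let c := p * w * (q ^ 2 - 1) * (z - w) / ((z * q ^ 2 - w) * (z * q ^ 3 - w))
  let d := q ^ 2 * (z - w) * (z * q - w) / ((z * q ^ 2 - w) * (z * q ^ 3 - w))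
  let e := a - z * w * (q ^ 2 - 1) * (q ^ 3 - 1) / ((z * q ^ 2 - w) * (z * q ^ 3 - w))
  let f := z * (q ^ 2 - 1) / (z * q ^ 2 - w)
  let g := -(p ^ 5) * z * (q ^ 2 - 1) * (z - w) / ((z * q ^ 2 - w) * (z * q ^ 3 - w))
  let r := w * (q ^ 2 - 1) * (q ^ 3 * z + q * (z - w) - w) / ((z * q ^ 2 - w) * (z * q ^ 3 - w))
  let s := z * (q ^ 2 - 1) * (q ^ 3 * z + q ^ 2 * (z - w) - w) / ((z * q ^ 2 - w) * (z * q ^ 3 - w))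
  Matrix.of fun i j : Fin 3 × Fin 3 =>
    if i = (0, 0) ∧ j = (0, 0) then 1
    else if i = (2, 2) ∧ j = (2, 2) then 1
    else if i = (0, 1) ∧ j = (0, 1) then a
    else if i = (1, 0) ∧ j = (1, 0) then a
    else if i = (1, 2) ∧ j = (1, 2) then a
    else if i = (2, 1) ∧ j = (2, 1) then a
    else if i = (0, 1) ∧ j = (1, 0) then b
    else if i = (1, 2) ∧ j = (2, 1) then b
    else if i = (1, 0) ∧ j = (0, 1) then f
    else if i = (2, 1) ∧ j = (1, 2) then f
    else if i = (0, 2) ∧ j = (0, 2) then d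
    else if i = (2, 0) ∧ j = (2, 0) then d
    else if i = (0, 2) ∧ j = (1, 1) then c
    else if i = (1, 1) ∧ j = (2, 0) then c
    else if i = (1, 1) ∧ j = (0, 2) then g
    else if i = (2, 0) ∧ j = (1, 1) then g
    else if i = (1, 1) ∧ j = (1, 1) then e
    else if i = (0, 2) ∧ j = (2, 0) then r
    else if i = (2, 0) ∧ j = (0, 2) then s
    else 0

/-- The graded permutation matrix `τ`, with entries
`τ_{(α,β),(α',β')} = δ_{α,β'} δ_{β,α'} (−1)^{[α][β]}`. -/
noncomputable def tau {K : Type*} [Field K] :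
    Matrix (Fin 3 × Fin 3) (Fin 3 × Fin 3) K :=
  Matrix.of fun i j =>
    if i.1 = j.2 ∧ i.2 = j.1 then (-1 : K) ^ (par i.1 * par i.2) else 0

/-- The field `ℚ(p, x)` of rational functions over `ℚ` in two variables. -/
abbrev F2 : Type := FractionRing (MvPolynomial (Fin 2) ℚ)

/-- The variable `p` (with `q = p^2`) in `ℚ(p, x)`. -/
noncomputable def pv : F2 := algebraMap (MvPolynomial (Fin 2) ℚ) F2 (MvPolynomial.X 0)

/-- The spectral-parameter variable `x` in `ℚ(p, x)`. -/
noncomputable def xv : F2 := algebraMap (MvPolynomial (Fin 2) ℚ) F2 (MvPolynomial.X 1)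

/-- Conjugation by the graded permutation swaps both index pairs, up to sign. -/
theorem tau_mul_mul_tau_apply {K : Type*} [Field K]
    (M : Matrix (Fin 3 × Fin 3) (Fin 3 × Fin 3) K) (i j : Fin 3 × Fin 3) :
    (tau * M * tau : Matrix (Fin 3 × Fin 3) (Fin 3 × Fin 3) K) i j =
      (-1) ^ (par i.1 * par i.2) * M i.swap j.swap * (-1) ^ (par j.1 * par j.2) := by
  obtain ⟨i₁, i₂⟩ := i
  obtain ⟨j₁, j₂⟩ := j
  have hl : ∀ k, (tau * M : Matrix (Fin 3 × Fin 3) (Fin 3 × Fin 3) K) (i₁, i₂) k =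
      (-1) ^ (par i₁ * par i₂) * M (i₂, i₁) k := by
    intro k
    rw [Matrix.mul_apply, Finset.sum_eq_single (i₂, i₁)]
    · simp [tau]
    · rintro ⟨b₁, b₂⟩ - hb
      have : ¬(i₁ = b₂ ∧ i₂ = b₁) := by
        rintro ⟨rfl, rfl⟩
        exact hb rfl
      simp [tau, this]
    · simp
  rw [Matrix.mul_apply, Finset.sum_eq_single (j₂, j₁)]
  · rw [hl]
    simp [tau, mul_comm (par j₂)]
  · rintro ⟨b₁, b₂⟩ - hb
    have : ¬(b₁ = j₂ ∧ b₂ = j₁) := by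
      rintro ⟨rfl, rfl⟩
      exact hb rfl
    simp [tau, this]
  · simp

/-- The matrix with the sparsity pattern of `Rmat` and prescribed entries. -/
def vertexMatrix {K : Type*} [Field K] (a b c d e f g r s : K) :
    Matrix (Fin 3 × Fin 3) (Fin 3 × Fin 3) K :=
  Matrix.of fun i j : Fin 3 × Fin 3 =>
    if i = (0, 0) ∧ j = (0, 0) then 1
    else if i = (2, 2) ∧ j = (2, 2) then 1
    else if i = (0, 1) ∧ j = (0, 1) then a
    else if i = (1, 0) ∧ j = (1, 0) then a
    else if i = (1, 2) ∧ j = (1, 2) then a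
    else if i = (2, 1) ∧ j = (2, 1) then a
    else if i = (0, 1) ∧ j = (1, 0) then b
    else if i = (1, 2) ∧ j = (2, 1) then b
    else if i = (1, 0) ∧ j = (0, 1) then f
    else if i = (2, 1) ∧ j = (1, 2) then f
    else if i = (0, 2) ∧ j = (0, 2) then d
    else if i = (2, 0) ∧ j = (2, 0) then d
    else if i = (0, 2) ∧ j = (1, 1) then c
    else if i = (1, 1) ∧ j = (2, 0) then c
    else if i = (1, 1) ∧ j = (0, 2) then g
    else if i = (2, 0) ∧ j = (1, 1) then g
    else if i = (1, 1) ∧ j = (1, 1) then e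
    else if i = (0, 2) ∧ j = (2, 0) then r
    else if i = (2, 0) ∧ j = (0, 2) then s
    else 0

set_option maxHeartbeats 1000000 in
/-- Graded unitarity of two vertex matrices, reduced to its weight blocks. -/
theorem vertexMatrix_graded_unitarity {K : Type*} [Field K]
    {a b c d e f g r s a' b' c' d' e' f' g' r' s' : K}
    (h₁₁ : a * a' + f * f' = 1) (h₁₂ : a * b' + f * a' = 0)
    (h₂₁ : b * a' + a * f' = 0) (h₂₂ : b * b' + a * a' = 1)
    (k₁₁ : d * d' - g * g' + s * s' = 1) (k₁₂ : d * c' - g * e' + s * g' = 0)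
    (k₁₃ : d * r' - g * c' + s * d' = 0) (k₂₁ : -c * d' + e * g' - g * s' = 0)
    (k₂₂ : -c * c' + e * e' - g * g' = 1) (k₂₃ : -c * r' + e * c' - g * d' = 0)
    (k₃₁ : r * d' - c * g' + d * s' = 0) (k₃₂ : r * c' - c * e' + d * g' = 0)
    (k₃₃ : r * r' - c * c' + d * d' = 1) :
    (tau * vertexMatrix a b c d e f g r s * tau) * vertexMatrix a' b' c' d' e' f' g' r' s' = 1 := by
  ext ⟨i₁, i₂⟩ ⟨j₁, j₂⟩
  rw [Matrix.mul_apply, Fintype.sum_prod_type]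
  simp only [tau_mul_mul_tau_apply, Fin.sum_univ_three]
  fin_cases i₁ <;> fin_cases i₂ <;> fin_cases j₁ <;> fin_cases j₂ <;>
    simp [vertexMatrix, par] <;> grind

set_option maxHeartbeats 1000000 in
/-- Graded unitarity over an arbitrary field, away from the poles of `R(x)` and `R(x⁻¹)`. -/
theorem Rmat_graded_unitarity_of_ne {K : Type*} [Field K] (p x : K) (hx : x ≠ 0)
    (h₂ : p ^ 4 * x - 1 ≠ 0) (h₃ : p ^ 6 * x - 1 ≠ 0)
    (k₂ : p ^ 4 - x ≠ 0) (k₃ : p ^ 6 - x ≠ 0) :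
    (tau * Rmat p x * tau) * Rmat p x⁻¹ = 1 := by
  have e₂ : x⁻¹ * p ^ 4 - 1 = (p ^ 4 - x) / x := by field_simp
  have e₃ : x⁻¹ * p ^ 6 - 1 = (p ^ 6 - x) / x := by field_simp
  apply vertexMatrix_graded_unitarity <;>
    simp only [← pow_mul, Nat.reduceMul, mul_one, one_mul, e₂, e₃, mul_comm x (p ^ 4),
      mul_comm x (p ^ 6)] <;>
    field_simp <;> ring

/-- Graded unitarity at the images of the variables in any field containing `ℚ[p, x]`. -/
theorem Rmat_graded_unitarity_of_injective {K : Type*} [Field K]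
    (φ : MvPolynomial (Fin 2) ℚ →+* K) (hφ : Function.Injective φ) :
    (tau * Rmat (φ (MvPolynomial.X 0)) (φ (MvPolynomial.X 1)) * tau) *
      Rmat (φ (MvPolynomial.X 0)) (φ (MvPolynomial.X 1))⁻¹ = 1 := by
  have ne (P : MvPolynomial (Fin 2) ℚ) (h : MvPolynomial.eval ![2, 3] P ≠ 0) : φ P ≠ 0 := by
    rw [Ne, map_eq_zero_iff φ hφ]
    rintro rfl
    exact h (map_zero _)
  apply Rmat_graded_unitarity_of_ne
  · have h := ne (MvPolynomial.X 1) (by norm_num)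
    simpa only [map_sub, map_mul, map_pow, map_one] using h
  · have h := ne (MvPolynomial.X 0 ^ 4 * MvPolynomial.X 1 - 1) (by norm_num)
    simpa only [map_sub, map_mul, map_pow, map_one] using h
  · have h := ne (MvPolynomial.X 0 ^ 6 * MvPolynomial.X 1 - 1) (by norm_num)
    simpa only [map_sub, map_mul, map_pow, map_one] using h
  · have h := ne (MvPolynomial.X 0 ^ 4 - MvPolynomial.X 1) (by norm_num)
    simpa only [map_sub, map_mul, map_pow, map_one] using h
  · have h := ne (MvPolynomial.X 0 ^ 6 - MvPolynomial.X 1) (by norm_num)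
    simpa only [map_sub, map_mul, map_pow, map_one] using h

/-- the graded unitarity relation `R₂₁(x) = R(x⁻¹)⁻¹` for the R-matrix of
`U_q(osp(1,2)^)`: over `ℚ(p,x)` one has `(τ · R(x) · τ) · R(x⁻¹) = I₉`. -/
theorem Rmat_graded_unitarity :
    (tau * Rmat pv xv * tau) * Rmat pv xv⁻¹ = 1 := by
  exact Rmat_graded_unitarity_of_injective (algebraMap (MvPolynomial (Fin 2) ℚ) F2)
    (IsFractionRing.injective (MvPolynomial (Fin 2) ℚ) F2)
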